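/- Let D : ℝ → ℝ be continuously differentiable with D(x) > 0 for all x, and let c : ℝ³ × ℝ → ℝ be such that ∂c/∂t exists and, for a fixed time t, the map r ↦ c(r,t) is twice continuously differentiable with compact support and c satisfies the nonlinear diffusion equation ∂c/∂t(r,t) = div(D(c(·,t))∇c(·,t))(r) for all r. Then for every r ∈ ℝ³: c(r,t) = −(1/(4π)) ∫_{ℝ³} [ (1/D(c(r',t))) · ∂c/∂t(r',t) − ∇(r'' ↦ ln D(c(r'',t)))(r') · ∇c(·,t)(r') ] / ‖r − r'‖ dr'. -/

import Mathlib

open MeasureTheory Real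
open scoped RealInnerProductSpace

noncomputable section

/-- Euclidean space ℝ³. -/
abbrev E3 := EuclideanSpace ℝ (Fin 3)

/-- Laplacian of a scalar field: sum of second partial derivatives. -/
def lap (u : E3 → ℝ) (x : E3) : ℝ :=
  ∑ i : Fin 3,
    fderiv ℝ (fun y => fderiv ℝ u y (EuclideanSpace.single i 1)) x (EuclideanSpace.single i 1)

/-- Divergence of a vector field: sum of partial derivatives of its components. -/
def dvg (v : E3 → E3) (x : E3) : ℝ :=
  ∑ i : Fin 3, fderiv ℝ v x (EuclideanSpace.single i 1) i

open Set Filter Topology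

/-- The smoothed norm `x ↦ √(‖x‖² + ε²)`. -/
def smoothNorm (ε : ℝ) (x : E3) : ℝ := √(‖x‖ ^ 2 + ε ^ 2)

lemma smoothNorm_pos {ε : ℝ} (hε : 0 < ε) (x : E3) : 0 < smoothNorm ε x :=
  Real.sqrt_pos.2 (by positivity)

lemma smoothNorm_sq (ε : ℝ) (x : E3) : smoothNorm ε x ^ 2 = ‖x‖ ^ 2 + ε ^ 2 :=
  Real.sq_sqrt (by positivity)

@[fun_prop]
lemma continuous_smoothNorm (ε : ℝ) : Continuous (smoothNorm ε) := by
  unfold smoothNorm; fun_prop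

lemma norm_le_smoothNorm (ε : ℝ) (x : E3) : ‖x‖ ≤ smoothNorm ε x :=
  Real.le_sqrt_of_sq_le (by nlinarith [sq_nonneg ε])

lemma smoothNorm_smul {ε : ℝ} (hε : 0 < ε) (x : E3) :
    smoothNorm ε (ε • x) = ε * smoothNorm 1 x := by
  have h : ‖ε • x‖ ^ 2 + ε ^ 2 = ε ^ 2 * (‖x‖ ^ 2 + 1 ^ 2) := by
    rw [norm_smul, Real.norm_of_nonneg hε.le]; ring
  rw [smoothNorm, smoothNorm, h, Real.sqrt_mul (by positivity), Real.sqrt_sq hε.le]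

lemma hasLineDerivAt_smoothNorm {ε : ℝ} (hε : 0 < ε) (x : E3) (i : Fin 3) :
    HasLineDerivAt ℝ (smoothNorm ε) (x i / smoothNorm ε x) x (EuclideanSpace.single i 1) := by
  have h : HasFDerivAt (fun y : E3 => ‖y‖ ^ 2 + ε ^ 2) (2 • innerSL ℝ x) x :=
    (hasStrictFDerivAt_norm_sq x).hasFDerivAt.add_const _
  have hs := (h.sqrt (by positivity)).hasLineDerivAt (EuclideanSpace.single i 1)
  convert! hs using 1
  simp [EuclideanSpace.inner_single_right, smoothNorm]
  ring

lemma hasLineDerivAt_inv_smoothNorm {ε : ℝ} (hε : 0 < ε) (x : E3) (i : Fin 3) :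
    HasLineDerivAt ℝ (fun y => (smoothNorm ε y)⁻¹) (-(x i) / smoothNorm ε x ^ 3) x
      (EuclideanSpace.single i 1) := by
  have h0 := (smoothNorm_pos hε x).ne'
  have h := HasDerivAt.inv (hasLineDerivAt_smoothNorm hε x i) (by simpa using h0)
  refine HasDerivAt.congr_deriv h ?_
  simp only [zero_smul, add_zero]
  field_simp

lemma hasLineDerivAt_coord_div_smoothNorm {ε : ℝ} (hε : 0 < ε) (x : E3) (i : Fin 3) :
    HasLineDerivAt ℝ (fun y => -(y i) / smoothNorm ε y ^ 3)
      (3 * x i ^ 2 / smoothNorm ε x ^ 5 - 1 / smoothNorm ε x ^ 3) x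
      (EuclideanSpace.single i 1) := by
  have h0 := (smoothNorm_pos hε x).ne'
  have hc : HasLineDerivAt ℝ (fun y : E3 => -(y i)) (-1) x (EuclideanSpace.single i 1) := by
    have := ((EuclideanSpace.proj i : E3 →L[ℝ] ℝ).hasFDerivAt
      (x := x)).neg.hasLineDerivAt (EuclideanSpace.single i 1)
    simpa using! this
  have h := HasDerivAt.div hc (HasDerivAt.pow (hasLineDerivAt_smoothNorm hε x i) 3)
    (by simpa using h0)
  refine HasDerivAt.congr_deriv h ?_
  simp only [zero_smul, add_zero, Pi.pow_apply]
  field_simp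
  push_cast
  ring

lemma integral_lap_div_smoothNorm {v : E3 → ℝ} (hv : ContDiff ℝ 2 v) (hs : HasCompactSupport v)
    {ε : ℝ} (hε : 0 < ε) :
    ∫ x, lap v x * (smoothNorm ε x)⁻¹ = -∫ x, v x * (3 * ε ^ 2 / smoothNorm ε x ^ 5) := by
  have h0 (x) := (smoothNorm_pos hε x).ne'
  have hd (i : Fin 3) : ContDiff ℝ 1 fun y => fderiv ℝ v y (EuclideanSpace.single i 1) :=
    (hv.fderiv_right (m := 1) (by norm_num)).clm_apply contDiff_const
  have hds (i : Fin 3) : HasCompactSupport fun y => fderiv ℝ v y (EuclideanSpace.single i 1) :=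
    hs.fderiv_apply ℝ _
  have hdd (i : Fin 3) : Continuous fun x =>
      fderiv ℝ (fun y => fderiv ℝ v y (EuclideanSpace.single i 1)) x (EuclideanSpace.single i 1) :=
    ((hd i).continuous_fderiv (by norm_num)).clm_apply continuous_const
  have hdds (i : Fin 3) : HasCompactSupport fun x =>
      fderiv ℝ (fun y => fderiv ℝ v y (EuclideanSpace.single i 1)) x (EuclideanSpace.single i 1) :=
    (hds i).fderiv_apply ℝ _
  have hk : Continuous fun x => (smoothNorm ε x)⁻¹ := by fun_prop (disch := assumption)
  have hk1 (i : Fin 3) : Continuous fun x : E3 => -(x i) / smoothNorm ε x ^ 3 := by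
    fun_prop (disch := intro x; exact pow_ne_zero _ (h0 x))
  have hk2 (i : Fin 3) : Continuous fun x : E3 =>
      3 * x i ^ 2 / smoothNorm ε x ^ 5 - 1 / smoothNorm ε x ^ 3 := by
    fun_prop (disch := intro x; exact pow_ne_zero _ (h0 x))
  have int {f g : E3 → ℝ} (hf : Continuous f) (hfs : HasCompactSupport f) (hg : Continuous g) :
      Integrable fun x => f x * g x :=
    (hf.mul hg).integrable_of_hasCompactSupport hfs.mul_right
  have step (i : Fin 3) :
      ∫ x, fderiv ℝ (fun y => fderiv ℝ v y (EuclideanSpace.single i 1)) x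
        (EuclideanSpace.single i 1) * (smoothNorm ε x)⁻¹ =
      ∫ x, v x * (3 * x i ^ 2 / smoothNorm ε x ^ 5 - 1 / smoothNorm ε x ^ 3) := by
    have h1 := integral_bilinear_hasLineDerivAt_right_eq_neg_left_of_integrable
      (B := ContinuousLinearMap.mul ℝ ℝ) (μ := volume)
      (int (hdd i) (hdds i) hk) (int (hd i).continuous (hds i) (hk1 i))
      (int (hd i).continuous (hds i) hk)
      (fun x _ => ((hd i).differentiable (by norm_num) x).hasFDerivAt.hasLineDerivAt _)
      (fun x _ => hasLineDerivAt_inv_smoothNorm hε x i)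
    have h2 := integral_bilinear_hasLineDerivAt_right_eq_neg_left_of_integrable
      (B := ContinuousLinearMap.mul ℝ ℝ) (μ := volume)
      (int (hd i).continuous (hds i) (hk1 i)) (int hv.continuous hs (hk2 i))
      (int hv.continuous hs (hk1 i))
      (fun x _ => (hv.differentiable (by norm_num) x).hasFDerivAt.hasLineDerivAt _)
      (fun x _ => hasLineDerivAt_coord_div_smoothNorm hε x i)
    simp only [ContinuousLinearMap.mul_apply'] at h1 h2
    linarith
  simp only [lap, Finset.sum_mul]
  rw [integral_finsetSum _ fun i _ => int (hdd i) (hdds i) hk,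
    Finset.sum_congr rfl fun i _ => step i,
    ← integral_finsetSum _ fun i _ => int hv.continuous hs (hk2 i), ← integral_neg]
  congr 1 with x
  have hsq := smoothNorm_sq ε x
  rw [EuclideanSpace.norm_sq_eq, Fin.sum_univ_three] at hsq
  simp only [Real.norm_eq_abs, sq_abs] at hsq
  rw [Fin.sum_univ_three]
  have := h0 x
  field_simp
  linear_combination (-3 * v x) * hsq

lemma continuous_lap {v : E3 → ℝ} (hv : ContDiff ℝ 2 v) : Continuous (lap v) := by
  refine continuous_finsetSum _ fun i _ => ?_
  have hd : ContDiff ℝ 1 fun y => fderiv ℝ v y (EuclideanSpace.single i 1) :=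
    (hv.fderiv_right (m := 1) (by norm_num)).clm_apply contDiff_const
  exact (hd.continuous_fderiv (by norm_num)).clm_apply continuous_const

lemma hasCompactSupport_lap {v : E3 → ℝ} (hs : HasCompactSupport v) :
    HasCompactSupport (lap v) := by
  refine hs.mono' fun x hx => ?_
  contrapose! hx
  have h (i : Fin 3) : x ∉ tsupport fun z =>
      fderiv ℝ (fun y => fderiv ℝ v y (EuclideanSpace.single i 1)) z (EuclideanSpace.single i 1) :=
    fun hxi => hx (tsupport_fderiv_apply_subset ℝ _ (tsupport_fderiv_apply_subset ℝ _ hxi))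
  simp [lap, fun i => image_eq_zero_of_notMem_tsupport (h i)]

lemma locallyIntegrable_inv_norm : LocallyIntegrable fun x : E3 => ‖x‖⁻¹ := by
  intro x
  refine ⟨Metric.ball 0 (‖x‖ + 1), Metric.isOpen_ball.mem_nhds (by simp), ?_⟩
  rw [integrableOn_fun_norm_addHaar volume (f := fun y => y⁻¹)]
  refine (ContinuousOn.integrableOn_Icc (f := fun y : ℝ => y) (a := 0) (b := ‖x‖ + 1)
    continuousOn_id).mono_set Ioo_subset_Icc_self |>.congr_fun (fun y hy => ?_) measurableSet_Ioo
  have := hy.1.ne'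
  simp
  field_simp

lemma integral_inv_smoothNorm_pow_five :
    ∫ x : E3, 3 / smoothNorm 1 x ^ 5 = 4 * π := by
  have hpos (y : ℝ) : 0 < √(y ^ 2 + 1 ^ 2) := Real.sqrt_pos.2 (by positivity)
  have h1 : ∫ y in Ioi (0 : ℝ), y ^ 2 * (3 / √(y ^ 2 + 1 ^ 2) ^ 5) = 1 - 0 := by
    have hlim : Tendsto (fun y : ℝ => (y / √(y ^ 2 + 1 ^ 2)) ^ 3) atTop (𝓝 1) := by
      have hinv : Tendsto (fun y : ℝ => (√(1 + (y⁻¹) ^ 2))⁻¹ ^ 3) atTop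
          (𝓝 ((√(1 + 0 ^ 2))⁻¹ ^ 3)) :=
        (((tendsto_const_nhds.add (tendsto_inv_atTop_zero.pow 2)).sqrt).inv₀ (by simp)).pow 3
      simp only [ne_eq, OfNat.ofNat_ne_zero, not_false_eq_true, zero_pow, add_zero, sqrt_one,
        inv_one, one_pow] at hinv
      refine hinv.congr' ?_
      filter_upwards [eventually_gt_atTop 0] with y hy
      have : y ^ 2 + 1 ^ 2 = y ^ 2 * (1 + y⁻¹ ^ 2) := by field_simp
      rw [this, Real.sqrt_mul (by positivity), Real.sqrt_sq hy.le]
      field_simp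
    have := integral_Ioi_of_hasDerivAt_of_nonneg' (a := 0)
      (g := fun y : ℝ => (y / √(y ^ 2 + 1 ^ 2)) ^ 3)
      (g' := fun y : ℝ => y ^ 2 * (3 / √(y ^ 2 + 1 ^ 2) ^ 5)) (fun y _ => ?_)
      (fun y _ => by have := hpos y; positivity) hlim
    · simpa using this
    · have hd := ((hasDerivAt_id y).div
        ((((hasDerivAt_id y).pow 2).add_const (1 ^ 2)).sqrt (by simp; positivity))
        (by simpa using (hpos y).ne')).pow 3
      refine HasDerivAt.congr_deriv hd ?_
      have hp := (hpos y).ne'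
      have hsq := Real.sq_sqrt (show 0 ≤ y ^ 2 + 1 ^ 2 by positivity)
      simp only [id, Pi.pow_apply, Pi.div_apply]
      set s := √(y ^ 2 + 1 ^ 2)
      push_cast
      field_simp
      linear_combination y ^ 2 * hsq
  have h2 := integral_fun_norm_addHaar (volume : Measure E3)
    (fun y => 3 / √(y ^ 2 + 1 ^ 2) ^ 5)
  simp only [smoothNorm]
  rw [h2]
  simp only [finrank_euclideanSpace, Fintype.card_fin, Nat.add_one_sub_one, smul_eq_mul,
    Measure.real, EuclideanSpace.volume_ball_fin_three, h1]
  simp [ENNReal.toReal_ofReal (show 0 ≤ π * 4 / 3 by positivity)]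
  ring

lemma integrable_inv_smoothNorm_pow_five :
    Integrable fun x : E3 => 3 / smoothNorm 1 x ^ 5 :=
  not_imp_comm.1 integral_undef (by rw [integral_inv_smoothNorm_pow_five]; positivity)

lemma tendsto_integral_mul_smoothNorm {v : E3 → ℝ} (hv : Continuous v)
    (hs : HasCompactSupport v) :
    Tendsto (fun ε : ℝ => ∫ x, v x * (3 * ε ^ 2 / smoothNorm ε x ^ 5)) (𝓝[>] 0)
      (𝓝 (4 * π * v 0)) := by
  obtain ⟨C, hC⟩ := hs.exists_bound_of_continuous hv
  have h : Tendsto (fun ε : ℝ => ∫ x, v (ε • x) * (3 / smoothNorm 1 x ^ 5)) (𝓝[>] 0)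
      (𝓝 (∫ x, v 0 * (3 / smoothNorm 1 x ^ 5))) := by
    refine tendsto_integral_filter_of_dominated_convergence
      (fun x => C * (3 / smoothNorm 1 x ^ 5)) ?_ ?_
      (integrable_inv_smoothNorm_pow_five.const_mul C) ?_
    · refine Eventually.of_forall fun ε => ?_
      exact ((hv.comp (continuous_const_smul ε)).aestronglyMeasurable).mul
        integrable_inv_smoothNorm_pow_five.aestronglyMeasurable
    · refine Eventually.of_forall fun ε => Eventually.of_forall fun x => ?_
      have hp := smoothNorm_pos one_pos x
      rw [norm_mul, Real.norm_of_nonneg (show 0 ≤ 3 / smoothNorm 1 x ^ 5 by positivity)]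
      gcongr
      exact hC _
    · refine Eventually.of_forall fun x => Tendsto.mul_const _ ?_
      have : Tendsto (fun ε : ℝ => v (ε • x)) (𝓝 0) (𝓝 (v ((0 : ℝ) • x))) :=
        (hv.comp (by fun_prop : Continuous fun ε : ℝ => ε • x)).tendsto 0
      rw [zero_smul] at this
      exact this.mono_left nhdsWithin_le_nhds
  rw [integral_const_mul, integral_inv_smoothNorm_pow_five, mul_comm] at h
  refine h.congr' ?_
  filter_upwards [self_mem_nhdsWithin] with ε (hε : 0 < ε)
  have hscale := Measure.integral_comp_smul (volume : Measure E3)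
    (fun x => v x * (3 * ε ^ 2 / smoothNorm ε x ^ 5)) ε
  have heq (x : E3) : v (ε • x) * (3 * ε ^ 2 / smoothNorm ε (ε • x) ^ 5) =
      (ε ^ 3)⁻¹ * (v (ε • x) * (3 / smoothNorm 1 x ^ 5)) := by
    rw [smoothNorm_smul hε]
    have := (smoothNorm_pos one_pos x).ne'
    field_simp
  simp only [heq, integral_const_mul, finrank_euclideanSpace, Fintype.card_fin,
    smul_eq_mul] at hscale
  rw [abs_of_pos (by positivity)] at hscale
  exact mul_left_cancel₀ (by positivity) hscale

lemma integral_lap_div_norm {v : E3 → ℝ} (hv : ContDiff ℝ 2 v) (hs : HasCompactSupport v) :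
    ∫ x, lap v x * ‖x‖⁻¹ = -(4 * π * v 0) := by
  have hint : Integrable fun x => lap v x * ‖x‖⁻¹ :=
    locallyIntegrable_inv_norm.integrable_smul_left_of_hasCompactSupport (continuous_lap hv)
      (hasCompactSupport_lap hs)
  have h : Tendsto (fun ε : ℝ => ∫ x, lap v x * (smoothNorm ε x)⁻¹) (𝓝[>] 0)
      (𝓝 (∫ x, lap v x * ‖x‖⁻¹)) := by
    have hne : ∀ᵐ x : E3, x ≠ 0 := compl_mem_ae_iff.2 (measure_singleton _)
    refine tendsto_integral_filter_of_dominated_convergence _ ?_ ?_ hint.norm ?_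
    · refine Eventually.of_forall fun ε => ?_
      exact ((continuous_lap hv).measurable.mul
        (continuous_smoothNorm ε).measurable.inv).aestronglyMeasurable
    · refine Eventually.of_forall fun ε => ?_
      filter_upwards [hne] with x hx
      have hp := norm_pos_iff.2 hx
      have hle := norm_le_smoothNorm ε x
      rw [norm_mul, norm_mul, norm_inv, norm_inv, norm_norm,
        Real.norm_of_nonneg (hp.le.trans hle)]
      gcongr
    · filter_upwards [hne] with x hx
      have hc : Tendsto (fun ε : ℝ => smoothNorm ε x) (𝓝 0) (𝓝 ‖x‖) := by
        have : Continuous fun ε : ℝ => smoothNorm ε x := by unfold smoothNorm; fun_prop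
        simpa [smoothNorm] using this.tendsto 0
      exact ((hc.mono_left nhdsWithin_le_nhds).inv₀ (norm_ne_zero_iff.2 hx)).const_mul _
  refine tendsto_nhds_unique h ((tendsto_integral_mul_smoothNorm hv.continuous hs).neg.congr' ?_)
  filter_upwards [self_mem_nhdsWithin] with ε hε
  exact (integral_lap_div_smoothNorm hv hs hε).symm

lemma lap_comp_add_right (u : E3 → ℝ) (r x : E3) :
    lap (fun y => u (y + r)) x = lap u (x + r) := by
  simp only [lap, fderiv_comp_add_right]
  refine Finset.sum_congr rfl fun i _ => ?_
  rw [fderiv_comp_add_right (f := fun y => fderiv ℝ u y (EuclideanSpace.single i 1))]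

/-- A compactly supported `C²` function is the Newtonian potential of its Laplacian. -/
theorem eq_integral_lap_div_norm_sub {u : E3 → ℝ} (hu : ContDiff ℝ 2 u)
    (hs : HasCompactSupport u) (r : E3) :
    u r = -(1 / (4 * π)) * ∫ x, lap u x / ‖r - x‖ := by
  have h := integral_lap_div_norm (v := fun y => u (y + r)) (by fun_prop)
    (hs.comp_homeomorph (Homeomorph.addRight r))
  rw [← integral_add_right_eq_self _ r]
  simp only [lap_comp_add_right, zero_add] at h
  simp only [sub_add_cancel_right, norm_neg, div_eq_mul_inv, h]
  field_simp

lemma gradient_apply {u : E3 → ℝ} (x : E3) (i : Fin 3) :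
    gradient u x i = fderiv ℝ u x (EuclideanSpace.single i 1) := by
  rw [← inner_gradient_left, EuclideanSpace.inner_single_right]
  simp

lemma dvg_smul_gradient {a u : E3 → ℝ} {x : E3} (ha : DifferentiableAt ℝ a x)
    (hu : ContDiff ℝ 2 u) :
    dvg (fun y => a y • gradient u y) x =
      a x * lap u x + ⟪gradient a x, gradient u x⟫ := by
  have hg : Differentiable ℝ (gradient u) := by
    have h : ContDiff ℝ 1 (gradient u) :=
      (InnerProductSpace.toDual ℝ E3).symm.contDiff.comp (hu.fderiv_right (m := 1) (by norm_num))
    exact h.differentiable (by norm_num)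
  have hgi (i : Fin 3) (w : E3) : fderiv ℝ (gradient u) x w i =
      fderiv ℝ (fun y => fderiv ℝ u y (EuclideanSpace.single i 1)) x w := by
    simp only [← gradient_apply]
    have := ((EuclideanSpace.proj i : E3 →L[ℝ] ℝ).hasFDerivAt.comp x
      (hg x).hasFDerivAt).fderiv
    exact (DFunLike.congr_fun this w).symm
  simp only [dvg, lap, fderiv_fun_smul ha (hg x), PiLp.inner_apply, Finset.mul_sum,
    ← Finset.sum_add_distrib]
  refine Finset.sum_congr rfl fun i _ => ?_
  simp [hgi, gradient_apply, mul_comm]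

lemma gradient_log_comp {a : E3 → ℝ} {x : E3} (ha : DifferentiableAt ℝ a x) (h0 : a x ≠ 0) :
    gradient (fun y => Real.log (a y)) x = (a x)⁻¹ • gradient a x := by
  rw [gradient, (ha.hasFDerivAt.log h0).fderiv, map_smul, gradient]

/-- the general integro-differential equation for nonlinear diffusion:
c(r,t) = −(1/4π)∫ [ (1/D(c))∂c/∂t − ∇(ln D(c))·∇c ] / ‖r−r'‖ dr'. -/
theorem diffusion_integro_differential (D : ℝ → ℝ) (hD : ContDiff ℝ 1 D)
    (hD0 : ∀ x, 0 < D x)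
    (c : E3 → ℝ → ℝ)
    (hc_time : ∀ (r : E3) (s : ℝ), DifferentiableAt ℝ (c r) s)
    (t : ℝ)
    (hc_space : ContDiff ℝ 2 (fun r => c r t))
    (hc_supp : HasCompactSupport (fun r => c r t))
    (hpde : ∀ r : E3,
      deriv (c r) t = dvg (fun r' => D (c r' t) • gradient (fun x => c x t) r') r)
    (r : E3) :
    c r t = -(1 / (4 * π)) * ∫ r' : E3,
      ((1 / D (c r' t)) * deriv (c r') t
        - ⟪gradient (fun r'' => Real.log (D (c r'' t))) r',
            gradient (fun x => c x t) r'⟫) / ‖r - r'‖ := by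
  rw [eq_integral_lap_div_norm_sub hc_space hc_supp r]
  congr! 4 with x
  have ha : DifferentiableAt ℝ (fun y => D (c y t)) x :=
    ((hD.differentiable (by norm_num)).comp (hc_space.differentiable (by norm_num))) x
  have h0 := (hD0 (c x t)).ne'
  rw [hpde, dvg_smul_gradient ha hc_space, gradient_log_comp ha h0, real_inner_smul_left]
  field_simp
  ring

end
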